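/- Let Ĉ, C₀ be L×L real matrices with Ĉ invertible, let 𝓜 be an L×L diagonal matrix, and let b̂ ∈ ℝ^L. Suppose Λ* ∈ ℝ^L satisfies (Ĉ + 𝓜 C₀) Λ* = (I − 𝓜) b̂ and Λ̃ ∈ ℝ^L satisfies Ĉ Λ̃ = b̂. Then Λ̃ = Λ* + Ĉ^{−1} 𝓜 (b̂ + C₀ Λ*). Moreover, if Ĉ is upper triangular (so that Ĉ^{−1} is upper triangular) and 𝓜 = diag(μ₁, …, μ_L) with μ_k ≥ 0, then for every h, |Λ̃_h − Λ*_h| ≤ (max_{h ≤ k ≤ L} μ_k) · Σ_{k=h}^L |(Ĉ^{−1})_{hk}| · |(b̂ + C₀ Λ*)_k|. -/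

import Mathlib

open Matrix

/-- If `(Ĉ + 𝓜 C₀) Λ* = (I - 𝓜) b̂` and `Ĉ Λ̃ = b̂` with `Ĉ` invertible,
then `Λ̃ = Λ* + Ĉ⁻¹ 𝓜 (b̂ + C₀ Λ*)`; moreover, if `Ĉ` is upper triangular and
`𝓜 = diag(μ₁, …, μ_L)` with `μ_k ≥ 0`, then for every `h`,
`|Λ̃_h - Λ*_h| ≤ (max_{h ≤ k ≤ L} μ_k) ∑_{k=h}^L |(Ĉ⁻¹)_{hk}| |(b̂ + C₀ Λ*)_k|`. -/
theorem stmt15 (L : ℕ) (Chat C0 : Matrix (Fin L) (Fin L) ℝ)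
    (hinv : IsUnit Chat.det) (mu : Fin L → ℝ) (bhat Λs Λt : Fin L → ℝ)
    (hopt : (Chat + Matrix.diagonal mu * C0).mulVec Λs =
      (1 - Matrix.diagonal mu).mulVec bhat)
    (hqo : Chat.mulVec Λt = bhat) :
    Λt = Λs + Chat⁻¹.mulVec ((Matrix.diagonal mu).mulVec (bhat + C0.mulVec Λs)) ∧
    (Chat.BlockTriangular id → (∀ k, 0 ≤ mu k) →
      ∀ h : Fin L, |Λt h - Λs h| ≤
        ((Finset.Ici h).sup' Finset.nonempty_Ici mu) *
          ∑ k ∈ Finset.Ici h, |Chat⁻¹ h k| * |(bhat + C0.mulVec Λs) k|) := by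
  have key : Λt = Λs + Chat⁻¹.mulVec ((Matrix.diagonal mu).mulVec (bhat + C0.mulVec Λs)) := by
    have h1 : (Matrix.diagonal mu).mulVec (bhat + C0.mulVec Λs) = Chat.mulVec (Λt - Λs) := by
      rw [Matrix.add_mulVec, Matrix.sub_mulVec, Matrix.one_mulVec, ← Matrix.mulVec_mulVec] at hopt
      rw [Matrix.mulVec_add, Matrix.mulVec_sub, hqo]
      funext i
      have h2 := congrFun hopt i
      simp only [Pi.add_apply, Pi.sub_apply] at h2 ⊢
      linarith
    rw [h1, Matrix.mulVec_mulVec, Matrix.nonsing_inv_mul _ hinv, Matrix.one_mulVec]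
    abel
  refine ⟨key, ?_⟩
  intro hT hmu h
  haveI : Invertible Chat := Matrix.invertibleOfIsUnitDet Chat hinv
  have hTi : (Chat⁻¹).BlockTriangular id := Matrix.blockTriangular_inv_of_blockTriangular hT
  generalize bhat + C0.mulVec Λs = v at key ⊢
  have h3 : Λt h - Λs h = ∑ k ∈ Finset.Ici h, Chat⁻¹ h k * (mu k * v k) := by
    have h4 := congrFun key h
    rw [Pi.add_apply] at h4
    rw [h4, add_sub_cancel_left]
    simp only [Matrix.mulVec_diagonal, Matrix.mulVec, dotProduct]
    symm
    simp only [Matrix.diagonal_apply, ite_mul, zero_mul, Finset.sum_ite_eq, Finset.mem_univ, if_true]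
    apply Finset.sum_subset (Finset.subset_univ _)
    intro k _ hk
    have hlt : k < h := by simpa using hk
    rw [hTi hlt, zero_mul]
  rw [h3, Finset.mul_sum]
  refine (Finset.abs_sum_le_sum_abs _ _).trans (Finset.sum_le_sum ?_)
  intro k hk
  rw [abs_mul, abs_mul, abs_of_nonneg (hmu k)]
  have h5 : mu k ≤ (Finset.Ici h).sup' Finset.nonempty_Ici mu := Finset.le_sup' mu hk
  calc |Chat⁻¹ h k| * (mu k * |v k|) = mu k * (|Chat⁻¹ h k| * |v k|) := by ring
    _ ≤ _ := mul_le_mul_of_nonneg_right h5 (by positivity)
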